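/- arXiv:1506.00067 — 3 statements merged into one kernel-verified Lean document; each statement's English description precedes it below -/
import Mathlib

section
/- Let (a,b) ∈ D₁ and suppose that 2a and 2b−1 are not dyadic rationals, so that there are unique sequences α, β ∈ Σ₂ with π(α) = 2a and π(β) = 2b−1. Then π⁻¹(Λ_{(a,b)}) = Σ_{(α,β)}. -/
open Filter MeasureTheory

namespace DoublingHole

/-- One-sided binary sequences (indexed from 0, corresponding to x₁x₂x₃⋯). -/
abbrev Seq : Type := ℕ → Bool

/-- The one-sided shift map σ. -/
def shift (x : Seq) : Seq := fun n => x (n + 1)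

/-- Strict lexicographic order ≺ on sequences. -/
def lexLt (x y : Seq) : Prop := ∃ k : ℕ, (∀ i, i < k → x i = y i) ∧ x k < y k

/-- Reflexive lexicographic order ≼ on sequences. -/
def lexLe (x y : Seq) : Prop := lexLt x y ∨ x = y

/-- The lexicographic subshift Σ_{(α,β)} = {x : β ≼ σⁿx ≼ α for all n ≥ 0}. -/
def lexSubshift (α β : Seq) : Set Seq :=
  {x | ∀ n : ℕ, lexLe β (shift^[n] x) ∧ lexLe (shift^[n] x) α}

/-- The projection π : Σ₂ → [0,1], π(x) = Σ xᵢ 2^{-i}. -/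
noncomputable def piMap (x : Seq) : ℝ := ∑' i : ℕ, if x i then (1 : ℝ) / 2 ^ (i + 1) else 0

/-- The mirror image x̄ of a sequence. -/
def mirror (x : Seq) : Seq := fun n => !(x n)

/-- The set P of Parry sequences: α₁ = 1 and σⁿα ≼ α for all n ≥ 1. -/
def ParryP : Set Seq := {α | α 0 = true ∧ ∀ n, 1 ≤ n → lexLe (shift^[n] α) α}

/-- The set P̄ of mirror images of Parry sequences. -/
def barP : Set Seq := {β | mirror β ∈ ParryP}

/-- Periodic sequences. -/
def PerSet : Set Seq := {x | ∃ k, 1 ≤ k ∧ shift^[k] x = x}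

/-- Membership in the lexicographic world LW. -/
def inLW (α β : Seq) : Prop :=
  α ∈ ParryP ∧ β ∈ barP ∧ ∀ n, 1 ≤ n → lexLe β (shift^[n] α) ∧ lexLe (shift^[n] β) α

/-- The doubling map x ↦ 2x (mod 1) on S¹ identified with [0,1). -/
noncomputable def dbl (x : ℝ) : ℝ := Int.fract (2 * x)

/-- The exceptional set X_{(a,b)} of points whose orbit avoids the hole (a,b). -/
def Xset (a b : ℝ) : Set ℝ :=
  {x | x ∈ Set.Ico (0 : ℝ) 1 ∧ ∀ n : ℕ, dbl^[n] x ∉ Set.Ioo a b}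

/-- The attractor Λ_{(a,b)} = [2b-1, 2a] ∩ X_{(a,b)}. -/
def Lam (a b : ℝ) : Set ℝ := Set.Icc (2 * b - 1) (2 * a) ∩ Xset a b

/-- χ(a) = sup{b : X_{(a,b)} is uncountable}. -/
noncomputable def chiFn (a : ℝ) : ℝ :=
  sSup {b | b ∈ Set.Ico (0 : ℝ) 1 ∧ ¬ (Xset a b).Countable}

/-- The parameter region D₁. -/
def D1 : Set (ℝ × ℝ) :=
  {p | p.1 ∈ Set.Ioo (1/4 : ℝ) (1/2) ∧ p.2 ∈ Set.Ioo (1/2 : ℝ) (3/4) ∧ p.2 ≤ chiFn p.1}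

/-- The set S of parameters whose endpoints both fall into the hole. -/
def Sset : Set (ℝ × ℝ) :=
  {p | p ∈ D1 ∧ (∃ n, 1 ≤ n ∧ dbl^[n] p.1 ∈ Set.Ioo p.1 p.2) ∧
        ∃ m, 1 ≤ m ∧ dbl^[m] p.2 ∈ Set.Ioo p.1 p.2}

/-- The finite word w occurs in (is a factor of) the sequence x. -/
def occursIn (w : List Bool) (x : Seq) : Prop :=
  ∃ i : ℕ, w = List.ofFn fun j : Fin w.length => x (i + (j : ℕ))

/-- The language of a subshift: all finite factors of its elements. -/
def Lang (A : Set Seq) : Set (List Bool) := {w | ∃ x ∈ A, occursIn w x}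

/-- A set of sequences is a subshift of finite type if it is defined by
finitely many forbidden words. -/
def IsSFT (A : Set Seq) : Prop :=
  ∃ F : Finset (List Bool), A = {x | ∀ w ∈ F, ¬ occursIn w x}

/-- B_n(A): the admissible words of length n. -/
def wordsOfLen (A : Set Seq) (n : ℕ) : Set (List Bool) :=
  {w | w.length = n ∧ w ∈ Lang A}

/-- Topological transitivity of a subshift, phrased via its language. -/
def TransitiveShift (A : Set Seq) : Prop :=
  ∀ u ∈ Lang A, ∀ v ∈ Lang A, ∃ t ∈ Lang A, u ++ t ++ v ∈ Lang A

/-- Cyclic rotation of a finite word. -/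
def rot (w : List Bool) (k : ℕ) : List Bool := w.drop k ++ w.take k

/-- Lexicographic (dictionary) order on finite words. -/
def listLe (u v : List Bool) : Prop := List.Lex (· < ·) u v ∨ u = v

/-- w = 0-max_w : w starts with 0 and is the lexicographically largest
cyclic permutation of itself starting with 0. -/
def isZeroMax (w : List Bool) : Prop :=
  w.headD true = false ∧
    ∀ k, k < w.length → (rot w k).headD true = false → listLe (rot w k) w

/-- w = 1-min_w : w starts with 1 and is the lexicographically smallest
cyclic permutation of itself starting with 1. -/
def isOneMin (w : List Bool) : Prop :=
  w.headD false = true ∧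
    ∀ k, k < w.length → (rot w k).headD false = true → listLe w (rot w k)

/-- v is the 0-max cyclic permutation of w. -/
def isZeroMaxOf (v w : List Bool) : Prop :=
  (∃ k, k < w.length ∧ v = rot w k) ∧ v.headD true = false ∧
    ∀ k, k < w.length → (rot w k).headD true = false → listLe (rot w k) v

/-- u is the 1-min cyclic permutation of w. -/
def isOneMinOf (u w : List Bool) : Prop :=
  (∃ k, k < w.length ∧ u = rot w k) ∧ u.headD false = true ∧
    ∀ k, k < w.length → (rot w k).headD false = true → listLe u (rot w k)

/-- The periodic sequence w^∞. -/
def periodicSeq (w : List Bool) : Seq := fun i => w.getD (i % w.length) false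

/-- The sequence w followed by x. -/
def wordThen (w : List Bool) (x : Seq) : Seq :=
  fun i => if i < w.length then w.getD i false else x (i - w.length)

/-- Prepend one symbol to a sequence (e.g. 0α, 1β). -/
def consSeq (a : Bool) (x : Seq) : Seq := fun i => if i = 0 then a else x (i - 1)

/-- A word is balanced if any two factors of equal length have numbers of 1's
differing by at most one. -/
def balanced (w : List Bool) : Prop :=
  ∀ u v : List Bool, u <:+: w → v <:+: w → u.length = v.length →
    ((u.count true : ℤ) - (v.count true : ℤ)).natAbs ≤ 1

/-- A word is cyclically balanced if its square is balanced. -/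
def cycBalanced (w : List Bool) : Prop := balanced (w ++ w)

/-- Infinite concatenation of a sequence of (nonempty) finite words. -/
noncomputable def concatSeq (b : ℕ → List Bool) : Seq := fun i =>
  (b (sInf {n : ℕ | i < ∑ k ∈ Finset.range (n + 1), (b k).length})).getD
    (i - ∑ k ∈ Finset.range (sInf {n : ℕ | i < ∑ k ∈ Finset.range (n + 1), (b k).length}), (b k).length)
    false

/-- (α,β) is renormalisable by the finite words ω and ν:
ω = 0-max_ω, ν = 1-min_ν, (0-max_ν)^∞ ≺ ω^∞, ν^∞ ≺ (1-min_ω)^∞, ℓ(ων) ≥ 3, and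
0α = ω ν^{n₁^ν} ω^{n₁^ω} ν^{n₂^ν} ⋯ and 1β = ν ω^{m₁^ω} ν^{m₁^ν} ⋯ with all
exponents in ℕ ∪ {∞}; equivalently 0α (resp. 1β) is an infinite concatenation of
copies of ω and ν whose first two blocks are ω, ν (resp. ν, ω). -/
def RenormalisableBy (α β : Seq) (ω ν : List Bool) : Prop :=
  isZeroMax ω ∧ isOneMin ν ∧
  (∀ v, isZeroMaxOf v ν → lexLt (periodicSeq v) (periodicSeq ω)) ∧
  (∀ u, isOneMinOf u ω → lexLt (periodicSeq ν) (periodicSeq u)) ∧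
  3 ≤ ω.length + ν.length ∧
  (∃ b : ℕ → List Bool, b 0 = ω ∧ b 1 = ν ∧ (∀ k, b k = ω ∨ b k = ν) ∧
    consSeq false α = concatSeq b) ∧
  (∃ c : ℕ → List Bool, c 0 = ν ∧ c 1 = ω ∧ (∀ k, c k = ω ∨ c k = ν) ∧
    consSeq true β = concatSeq c)

/-- (α,β) is renormalisable by an infinite sequence: either 0α = ω and 1β = νω
with ω infinite and ν = 1-min_ν finite, or 0α = ων and 1β = ν with ν infinite
and ω = 0-max_ω finite. -/
def RenormInfBy (α β : Seq) : Prop :=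
  (∃ ν : List Bool, isOneMin ν ∧ consSeq true β = wordThen ν (consSeq false α)) ∨
  (∃ ω : List Bool, isZeroMax ω ∧ consSeq false α = wordThen ω (consSeq true β))

/-- n_α = min{n ≥ 1 : σⁿα ≻ α}. -/
noncomputable def nAlpha (α : Seq) : ℕ := sInf {n | 1 ≤ n ∧ lexLt α (shift^[n] α)}

/-- The periodic sequence (α₁ ⋯ α_{n-1} 0)^∞. -/
def cutZero (α : Seq) (n : ℕ) : Seq :=
  fun i => if i % n = n - 1 then false else α (i % n)

/-- The periodic sequence (β₁ ⋯ β_{n-1} 1)^∞. -/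
def cutOne (β : Seq) (n : ℕ) : Seq :=
  fun i => if i % n = n - 1 then true else β (i % n)

open Classical in
/-- The map ς : Σ₂¹ → Σ₂¹. -/
noncomputable def varsigma (α : Seq) : Seq :=
  if α ∈ ParryP then α else cutZero α (nAlpha α)

/-- The map ς' : Σ₂⁰ → Σ₂⁰, ς'(β) = mirror of ς(β̄). -/
noncomputable def varsigma' (β : Seq) : Seq := mirror (varsigma (mirror β))

/-- M_α(β) = min{m ≥ 1 : σ^m β ≻ α}. -/
noncomputable def Msub (α β : Seq) : ℕ := sInf {m | 1 ≤ m ∧ lexLt α (shift^[m] β)}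

/-- N_β(α) = min{n ≥ 1 : σⁿ α ≺ β}. -/
noncomputable def Nsub (α β : Seq) : ℕ := sInf {n | 1 ≤ n ∧ lexLt (shift^[n] α) β}

/-- ι(α) = (α₁ ⋯ α_{N_β(α)-1} 0)^∞. -/
noncomputable def iotaA (α β : Seq) : Seq := cutZero α (Nsub α β)

/-- ι(β) = (β₁ ⋯ β_{M_α(β)-1} 1)^∞. -/
noncomputable def iotaB (α β : Seq) : Seq := cutOne β (Msub α β)

/-- ξ_α(β) = (β₁ ⋯ β_{M-1} 1)^∞ with M = M_α(β). -/
noncomputable def xiA (α β : Seq) : Seq := cutOne β (Msub α β)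

/-- ξ'_β(α) = (α₁ ⋯ α_{N-1} 0)^∞ with N = N_β(α). -/
noncomputable def xiB (α β : Seq) : Seq := cutZero α (Nsub α β)

/-- A two sided extremal pair. -/
def twoSidedExtremal (α β : Seq) : Prop :=
  (∃ n, 1 ≤ n ∧ lexLt α (shift^[n] β)) ∧ (∃ m, 1 ≤ m ∧ lexLt (shift^[m] α) β)

/-- A right extremal pair. -/
def rightExtremal (α β : Seq) : Prop :=
  (∀ m, 1 ≤ m → lexLt β (shift^[m] α)) ∧ (∃ n, 1 ≤ n ∧ lexLt α (shift^[n] β))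

/-- A left extremal pair. -/
def leftExtremal (α β : Seq) : Prop :=
  (∀ n, 1 ≤ n → lexLt (shift^[n] β) α) ∧ (∃ m, 1 ≤ m ∧ lexLt (shift^[m] α) β)

/-- Dyadic rationals. -/
def IsDyadic (t : ℝ) : Prop := ∃ (z : ℤ) (n : ℕ), t = (z : ℝ) / 2 ^ n

/-- α₁ ⋯ α_n 1^∞. -/
def onesAfter (α : Seq) (n : ℕ) : Seq := fun i => if i < n then α i else true

end DoublingHole

namespace DoublingHole

theorem summable_piMap (x : Seq) :
    Summable fun i : ℕ => if x i then (1 : ℝ) / 2 ^ (i + 1) else 0 := by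
  have hg : Summable fun i : ℕ => (1 / 2 : ℝ) / 2 ^ i := summable_geometric_two' 1
  refine Summable.of_nonneg_of_le (fun i => ?_) (fun i => ?_) hg
  · split_ifs <;> positivity
  · split_ifs
    · rw [pow_succ', div_div]
    · positivity

theorem piMap_nonneg (x : Seq) : 0 ≤ piMap x :=
  tsum_nonneg fun i => by split_ifs <;> positivity

theorem piMap_le_one (x : Seq) : piMap x ≤ 1 := by
  rw [← tsum_geometric_two' (1 : ℝ)]
  refine (summable_piMap x).tsum_le_tsum (fun i => ?_) (summable_geometric_two' 1)
  split_ifs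
  · rw [pow_succ', div_div]
  · positivity

theorem piMap_eq (x : Seq) :
    piMap x = ((if x 0 then 1 else 0) + piMap (shift x)) / 2 := by
  unfold piMap
  rw [(summable_piMap x).tsum_eq_zero_add, add_div, ← tsum_div_const]
  congr 1
  · split_ifs <;> simp
  · refine tsum_congr fun i => ?_
    change _ = (if x (i + 1) then (1 : ℝ) / 2 ^ (i + 1) else 0) / 2
    split_ifs
    · rw [pow_succ _ (i + 1), div_div]
    · simp

theorem IsDyadic.half {t : ℝ} (ht : IsDyadic t) : IsDyadic (t / 2) := by
  obtain ⟨z, n, rfl⟩ := ht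
  exact ⟨z, n + 1, by rw [pow_succ, div_div]⟩

theorem IsDyadic.one_add {t : ℝ} (ht : IsDyadic t) : IsDyadic (1 + t) := by
  obtain ⟨z, n, rfl⟩ := ht
  refine ⟨2 ^ n + z, n, ?_⟩
  push_cast
  field_simp

/-- The projection is weakly monotone, and can identify distinct sequences only over a
dyadic rational. -/
theorem lexLt.piMap_le {x y : Seq} (h : lexLt x y) :
    piMap x ≤ piMap y ∧ (piMap x = piMap y → IsDyadic (piMap y)) := by
  obtain ⟨k, hk, hlt⟩ := h
  induction k generalizing x y with
  | zero =>
    obtain ⟨hx, hy⟩ : x 0 = false ∧ y 0 = true := by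
      rw [Bool.lt_iff] at hlt
      exact hlt
    have h₁ := piMap_eq x
    have h₂ := piMap_eq y
    have h₃ := piMap_le_one (shift x)
    have h₄ := piMap_nonneg (shift y)
    simp only [hx, hy, if_true, Bool.false_eq_true, if_false] at h₁ h₂
    refine ⟨by linarith, fun he => ⟨1, 1, ?_⟩⟩
    norm_num
    linarith
  | succ k ih =>
    obtain ⟨hle, hd⟩ := ih (x := shift x) (y := shift y)
      (fun i hi => hk (i + 1) (by omega)) hlt
    rw [piMap_eq x, piMap_eq y, hk 0 (by omega)]
    refine ⟨by linarith, fun he => ?_⟩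
    have hy := hd (by linarith)
    split_ifs
    · exact hy.one_add.half
    · rw [zero_add]
      exact hy.half

theorem lexLe.piMap_le {x y : Seq} (h : lexLe x y) : piMap x ≤ piMap y := by
  rcases h with h | rfl
  · exact h.piMap_le.1
  · exact le_rfl

theorem lexLe_or_lexLt (x y : Seq) : lexLe x y ∨ lexLt y x := by
  classical
  by_cases h : x = y
  · exact Or.inl (Or.inr h)
  have hex : ∃ n, x n ≠ y n := Function.ne_iff.mp h
  have hmin : ∀ i, i < Nat.find hex → x i = y i := fun i hi =>
    not_not.mp (Nat.find_min hex hi)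
  rcases lt_or_gt_of_ne (Nat.find_spec hex) with hlt | hlt
  · exact Or.inl (Or.inl ⟨_, hmin, hlt⟩)
  · exact Or.inr ⟨_, fun i hi => (hmin i hi).symm, hlt⟩

theorem lexLe_of_piMap_le {x y : Seq} (h : piMap x ≤ piMap y)
    (hd : ¬ IsDyadic (piMap x) ∨ ¬ IsDyadic (piMap y)) : lexLe x y := by
  refine (lexLe_or_lexLt x y).resolve_right fun hlt => ?_
  have he : piMap y = piMap x := le_antisymm hlt.piMap_le.1 h
  have hx := hlt.piMap_le.2 he
  exact hd.elim (fun hn => hn hx) (fun hn => hn (he ▸ hx))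

theorem dbl_piMap {x : Seq} (h : piMap (shift x) < 1) : dbl (piMap x) = piMap (shift x) := by
  have hf : Int.fract (piMap (shift x)) = piMap (shift x) :=
    Int.fract_eq_self.mpr ⟨piMap_nonneg _, h⟩
  rw [dbl, piMap_eq x, mul_div_cancel₀ _ two_ne_zero]
  split_ifs
  · rw [add_comm, Int.fract_add_one, hf]
  · rw [zero_add, hf]

/-- A point of the attractor outside the hole is mapped into `[2b - 1, 2a]` again. -/
theorem piMap_shift_mem {a b : ℝ} (ha : a < 1 / 2) (hb : 1 / 2 < b) {x : Seq}
    (hx : piMap x ∈ Set.Icc (2 * b - 1) (2 * a)) (hh : piMap x ∉ Set.Ioo a b) :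
    piMap (shift x) ∈ Set.Icc (2 * b - 1) (2 * a) := by
  have h₀ := piMap_nonneg (shift x)
  have h₁ := piMap_le_one (shift x)
  have he := piMap_eq x
  obtain ⟨hl, hu⟩ := hx
  have hh' : piMap x ≤ a ∨ b ≤ piMap x := by
    by_contra! hc
    exact hh hc
  split_ifs at he
  · rcases hh' with h | h
    · linarith
    · constructor <;> linarith
  · rcases hh' with h | h
    · constructor <;> linarith
    · linarith

theorem piMap_notMem_hole {a b : ℝ} {x : Seq}
    (hx : piMap (shift x) ∈ Set.Icc (2 * b - 1) (2 * a)) : piMap x ∉ Set.Ioo a b := by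
  rintro ⟨h₁, h₂⟩
  obtain ⟨hl, hu⟩ := hx
  have he := piMap_eq x
  split_ifs at he <;> linarith

/-- For (a,b) ∈ D₁ with 2a and 2b−1 non-dyadic, so that the binary
expansions α, β with π(α) = 2a and π(β) = 2b−1 are unique,
π⁻¹(Λ_{(a,b)}) = Σ_{(α,β)}. -/
theorem statement0 (a b : ℝ) (hab : (a, b) ∈ D1)
    (hda : ¬ IsDyadic (2 * a)) (hdb : ¬ IsDyadic (2 * b - 1))
    (α β : Seq) (hα : piMap α = 2 * a) (hβ : piMap β = 2 * b - 1) :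
    piMap ⁻¹' Lam a b = lexSubshift α β := by
  obtain ⟨ha, hb, -⟩ := hab
  have ha' : a < 1 / 2 := ha.2
  have hb' : 1 / 2 < b := hb.1
  ext x
  constructor
  · rintro ⟨hI, -, hX⟩
    have key : ∀ n, piMap (shift^[n] x) ∈ Set.Icc (2 * b - 1) (2 * a) ∧
        dbl^[n] (piMap x) = piMap (shift^[n] x) := by
      intro n
      induction n with
      | zero => exact ⟨hI, rfl⟩
      | succ n ih =>
        have hm := piMap_shift_mem ha' hb' ih.1 (ih.2 ▸ hX n)
        rw [Function.iterate_succ_apply', Function.iterate_succ_apply', ih.2]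
        exact ⟨hm, dbl_piMap (by linarith [hm.2])⟩
    intro n
    obtain ⟨hl, hu⟩ := (key n).1
    exact ⟨lexLe_of_piMap_le (hβ ▸ hl) (Or.inl (hβ ▸ hdb)),
      lexLe_of_piMap_le (hα ▸ hu) (Or.inr (hα ▸ hda))⟩
  · intro hx
    have hm : ∀ n, piMap (shift^[n] x) ∈ Set.Icc (2 * b - 1) (2 * a) := fun n =>
      ⟨hβ ▸ (hx n).1.piMap_le, hα ▸ (hx n).2.piMap_le⟩
    have hit : ∀ n, dbl^[n] (piMap x) = piMap (shift^[n] x) := by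
      intro n
      induction n with
      | zero => rfl
      | succ n ih =>
        have hs := hm (n + 1)
        rw [Function.iterate_succ_apply'] at hs
        rw [Function.iterate_succ_apply', Function.iterate_succ_apply', ih]
        exact dbl_piMap (by linarith [hs.2])
    refine ⟨hm 0, ⟨piMap_nonneg x, by linarith [show piMap x ≤ 2 * a from (hm 0).2]⟩, fun n => ?_⟩
    rw [hit n]
    have hs := hm (n + 1)
    rw [Function.iterate_succ_apply'] at hs
    exact piMap_notMem_hole hs

end DoublingHole
end

section
/- The set S = {(a,b) ∈ D₁ : there exist n, m ≥ 1 with fⁿ(a) ∈ (a,b) and f^m(b) ∈ (a,b)} is open and dense in D₁ (with the subspace topology from ℝ²). -/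
open Filter MeasureTheory

namespace DoublingHole

theorem dbl_iterate_succ (n : ℕ) (x : ℝ) :
    dbl^[n + 1] x = Int.fract (2 ^ (n + 1) * x) := by
  induction n with
  | zero => simp [dbl]
  | succ n ih =>
    rw [Function.iterate_succ_apply', ih, dbl, Int.fract_eq_fract]
    refine ⟨-2 * ⌊(2 : ℝ) ^ (n + 1) * x⌋, ?_⟩
    rw [Int.fract]
    push_cast
    ring

/-- Iterates of the doubling map are continuous away from the preimages of `0`. -/
theorem continuousAt_dbl_iterate {n : ℕ} (hn : 1 ≤ n) {x : ℝ} (hx : 0 < dbl^[n] x) :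
    ContinuousAt dbl^[n] x := by
  obtain ⟨n, rfl⟩ := Nat.exists_eq_add_of_le' hn
  have hfun : dbl^[n + 1] = fun y => Int.fract ((2 : ℝ) ^ (n + 1) * y) :=
    funext (dbl_iterate_succ n)
  rw [hfun] at hx ⊢
  have hfract : ContinuousAt (Int.fract : ℝ → ℝ) (2 ^ (n + 1) * x) :=
    continuousAt_fract (sub_pos.1 hx).ne'
  exact ContinuousAt.comp (f := fun y : ℝ => 2 ^ (n + 1) * y) (g := Int.fract) hfract (by fun_prop)

/-- The preimages of `1/2` under the iterates of the doubling map are dense. -/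
theorem exists_dbl_iterate_eq_half {x y : ℝ} (hxy : x < y) :
    ∃ z ∈ Set.Ioo x y, ∃ n, 1 ≤ n ∧ dbl^[n] z = 1 / 2 := by
  obtain ⟨n, hn⟩ := exists_pow_lt_of_lt_one (show (0 : ℝ) < (y - x) / 2 by linarith)
    (show (1 / 2 : ℝ) < 1 by norm_num)
  have hpos : (0 : ℝ) < 2 ^ (n + 1) := by positivity
  have hlen : 2 < 2 ^ (n + 1) * (y - x) := by
    rw [one_div, inv_pow, inv_lt_iff_one_lt_mul₀ (by positivity)] at hn
    rw [pow_succ]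
    nlinarith
  have hle := Int.le_ceil ((2 : ℝ) ^ (n + 1) * x)
  have hlt := Int.ceil_lt_add_one ((2 : ℝ) ^ (n + 1) * x)
  refine ⟨(⌈(2 : ℝ) ^ (n + 1) * x⌉ + 1 / 2) / 2 ^ (n + 1), ⟨?_, ?_⟩, n + 1, by omega, ?_⟩
  · rw [lt_div_iff₀ hpos]
    linarith
  · rw [div_lt_iff₀ hpos]
    linarith
  · rw [dbl_iterate_succ, mul_div_cancel₀ _ hpos.ne', Int.fract_intCast_add, Int.fract_eq_self]
    norm_num

theorem Xset_subset_Xset {a a' : ℝ} (h : a ≤ a') (b : ℝ) : Xset a b ⊆ Xset a' b :=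
  fun _ hx => ⟨hx.1, fun n hn => hx.2 n ⟨h.trans_lt hn.1, hn.2⟩⟩

theorem chiFn_le_chiFn {a a' : ℝ} (h : a ≤ a') (hpos : 0 < chiFn a) :
    chiFn a ≤ chiFn a' := by
  refine csSup_le_csSup ⟨1, fun b hb => hb.1.2.le⟩ ?_
    fun b hb => ⟨hb.1, fun hc => hb.2 (hc.mono (Xset_subset_Xset h b))⟩
  by_contra hne
  rw [Set.not_nonempty_iff_eq_empty] at hne
  rw [chiFn, hne, Real.sSup_empty] at hpos
  exact hpos.false

theorem mem_D1_of_le {a a' b b' : ℝ} (h : (a, b) ∈ D1) (ha : a ≤ a') (ha' : a' < 1 / 2)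
    (hb : b' ≤ b) (hb' : 1 / 2 < b') : (a', b') ∈ D1 := by
  obtain ⟨h₁, h₂, h₃⟩ := h
  dsimp only at h₁ h₂ h₃
  exact ⟨⟨h₁.1.trans_le ha, ha'⟩, ⟨hb', hb.trans_lt h₂.2⟩,
    hb.trans (h₃.trans (chiFn_le_chiFn ha (by linarith [h₂.1])))⟩

theorem eventually_mem_Ioo {g : ℝ × ℝ → ℝ} {p : ℝ × ℝ} (hg : ContinuousAt g p)
    (hp : g p ∈ Set.Ioo p.1 p.2) : ∀ᶠ q in nhds p, g q ∈ Set.Ioo q.1 q.2 :=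
  (continuousAt_fst.eventually_lt hg hp.1).and (hg.eventually_lt continuousAt_snd hp.2)

theorem eventually_mem_Sset {p : ℝ × ℝ} (hp : p ∈ Sset) :
    ∀ᶠ q in nhds p, q ∈ D1 → q ∈ Sset := by
  obtain ⟨⟨h₁, -, -⟩, ⟨n, hn, hna⟩, m, hm, hmb⟩ := hp
  have hpos : 0 < p.1 := by linarith [h₁.1]
  have ha := eventually_mem_Ioo (g := fun q => dbl^[n] q.1)
    ((continuousAt_dbl_iterate hn (hpos.trans hna.1)).comp continuousAt_fst) hna
  have hb := eventually_mem_Ioo (g := fun q => dbl^[m] q.2)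
    ((continuousAt_dbl_iterate hm (hpos.trans hmb.1)).comp continuousAt_snd) hmb
  filter_upwards [ha, hb] with q hqa hqb hq
  exact ⟨hq, ⟨n, hn, hqa⟩, m, hm, hqb⟩

theorem exists_mem_Sset_dist_lt {p : ℝ × ℝ} (hp : p ∈ D1) {ε : ℝ} (hε : 0 < ε) :
    ∃ q ∈ Sset, dist p q < ε := by
  obtain ⟨a, b⟩ := p
  obtain ⟨h₁, h₂, -⟩ := id hp
  dsimp only at h₁ h₂
  obtain ⟨a', ⟨haa', ha'⟩, n, hn, hna⟩ :=
    exists_dbl_iterate_eq_half (lt_min h₁.2 (lt_add_of_pos_right a hε))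
  obtain ⟨b', ⟨hb', hbb'⟩, m, hm, hmb⟩ :=
    exists_dbl_iterate_eq_half (max_lt h₂.1 (sub_lt_self b hε))
  rw [lt_min_iff] at ha'
  rw [max_lt_iff] at hb'
  refine ⟨(a', b'), ⟨mem_D1_of_le hp haa'.le ha'.1 hbb'.le hb'.1, ⟨n, hn, ?_⟩, m, hm, ?_⟩, ?_⟩
  · rw [hna]
    exact ⟨ha'.1, hb'.1⟩
  · rw [hmb]
    exact ⟨ha'.1, hb'.1⟩
  · rw [Prod.dist_eq, max_lt_iff, Real.dist_eq, Real.dist_eq, abs_lt, abs_lt]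
    dsimp only
    refine ⟨⟨?_, ?_⟩, ?_, ?_⟩ <;> linarith [ha'.2, hb'.2]

/-- the set S is open and dense in D₁ (subspace topology). -/
theorem statement2 :
    IsOpen {p : ↥D1 | (p : ℝ × ℝ) ∈ Sset} ∧
    Dense {p : ↥D1 | (p : ℝ × ℝ) ∈ Sset} := by
  refine ⟨isOpen_iff_mem_nhds.2 fun p hp => ?_, fun p => Metric.mem_closure_iff.2 fun ε hε => ?_⟩
  · filter_upwards [continuous_subtype_val.continuousAt.eventually (eventually_mem_Sset hp)]
      with q hq using hq q.2
  · obtain ⟨q, hq, hpq⟩ := exists_mem_Sset_dist_lt p.2 hε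
    exact ⟨⟨q, hq.1⟩, hq, hpq⟩

end DoublingHole
end

section
/- The set P ∩ Per(σ) of periodic Parry sequences is dense in P with respect to the metric d. -/
open Filter MeasureTheory

namespace DoublingHole

theorem shift_iterate_apply (x : Seq) (n i : ℕ) : shift^[n] x i = x (i + n) := by
  induction n generalizing x with
  | zero => rfl
  | succ n ih => rw [Function.iterate_succ_apply, ih]; simp [shift, Nat.add_assoc]

/-- The periodic sequence `(α₁ ⋯ α_N 0^N)^∞`. -/
def zeroPad (α : Seq) (N : ℕ) : Seq :=
  fun i => if i % (2 * N) < N then α (i % (2 * N)) else false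

theorem zeroPad_of_lt (α : Seq) {N i : ℕ} (h : i < N) : zeroPad α N i = α i := by
  have : i % (2 * N) = i := Nat.mod_eq_of_lt (by omega)
  simp [zeroPad, this, h]

theorem zeroPad_of_le (α : Seq) {N i : ℕ} (h : N ≤ i) (h' : i < 2 * N) :
    zeroPad α N i = false := by
  have : i % (2 * N) = i := Nat.mod_eq_of_lt h'
  simp [zeroPad, this, h]

theorem zeroPad_add_mod (α : Seq) (N i n : ℕ) :
    zeroPad α N (i + n % (2 * N)) = zeroPad α N (i + n) := by
  simp [zeroPad]

theorem zeroPad_mem_PerSet (α : Seq) {N : ℕ} (hN : 0 < N) : zeroPad α N ∈ PerSet := by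
  refine ⟨2 * N, by omega, ?_⟩
  funext i
  rw [shift_iterate_apply, ← zeroPad_add_mod, Nat.mod_self, Nat.add_zero]

/-- A Parry sequence dominates its shifts at the first place where they differ. -/
theorem lt_of_first_ne {α : Seq} (hα : α ∈ ParryP) {r k : ℕ} (hr : 1 ≤ r)
    (heq : ∀ i < k, α (i + r) = α i) (hne : α (k + r) ≠ α k) : α (k + r) < α k := by
  rcases hα.2 r hr with ⟨m, hm, hlt⟩ | h
  · simp only [shift_iterate_apply] at hm hlt
    rcases lt_trichotomy m k with h | rfl | h
    · exact absurd (heq m h) hlt.ne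
    · exact hlt
    · exact absurd (hm k h) hne
  · exact absurd (by rw [← shift_iterate_apply α, h]) hne

/-- A nontrivial shift of `(α₁ ⋯ α_N 0^N)^∞` by less than `N` differs from it among the
first `N` places. -/
theorem exists_zeroPad_ne {α : Seq} (h0 : α 0 = true) {N r : ℕ} (hr : 0 < r) (hrN : r < N) :
    ∃ i < N, zeroPad α N (i + r) ≠ zeroPad α N i := by
  by_contra! h
  have hmul : ∀ k, k * r < N + r → zeroPad α N (k * r) = true := by
    intro k
    induction k with
    | zero => intro _; rw [Nat.zero_mul, zeroPad_of_lt α (by omega), h0]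
    | succ k ih =>
      intro hk
      rw [Nat.succ_mul] at hk ⊢
      rw [h _ (by omega), ih (by omega)]
  have hdm := Nat.div_add_mod (N - 1) r
  have hmod := Nat.mod_lt (N - 1) hr
  have hs : ((N - 1) / r + 1) * r = r * ((N - 1) / r) + r := by ring
  have h1 := hmul ((N - 1) / r + 1) (by omega)
  rw [zeroPad_of_le α (by omega) (by omega)] at h1
  exact Bool.false_ne_true h1

theorem zeroPad_mem_ParryP {α : Seq} (hα : α ∈ ParryP) {N : ℕ} (hN : 0 < N) :
    zeroPad α N ∈ ParryP := by
  have h0 : zeroPad α N 0 = true := by rw [zeroPad_of_lt α hN, hα.1]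
  refine ⟨h0, fun n _ => ?_⟩
  have hshift : ∀ i, shift^[n] (zeroPad α N) i = zeroPad α N (i + n % (2 * N)) := fun i => by
    rw [shift_iterate_apply, zeroPad_add_mod]
  have hrL : n % (2 * N) < 2 * N := Nat.mod_lt _ (by omega)
  generalize n % (2 * N) = r at hshift hrL
  rcases Nat.eq_zero_or_pos r with rfl | hr
  · exact Or.inr (funext hshift)
  left
  rcases Nat.lt_or_ge r N with hrN | hrN
  · classical
    have hex := exists_zeroPad_ne hα.1 hr hrN
    obtain ⟨hkN, hne⟩ := Nat.find_spec hex
    have hmin : ∀ i < Nat.find hex, zeroPad α N (i + r) = zeroPad α N i := fun i hi => by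
      have := Nat.find_min hex hi
      push Not at this
      exact this (by omega)
    generalize Nat.find hex = k at hkN hne hmin
    refine ⟨k, fun i hi => (hshift i).trans (hmin i hi), ?_⟩
    rw [hshift]
    rcases Nat.lt_or_ge (k + r) N with hkr | hkr
    · rw [zeroPad_of_lt α hkr, zeroPad_of_lt α hkN] at hne ⊢
      refine lt_of_first_ne hα hr (fun i hi => ?_) hne
      have := hmin i hi
      rwa [zeroPad_of_lt α (by omega), zeroPad_of_lt α (by omega)] at this
    · rw [zeroPad_of_le α hkr (by omega)] at hne ⊢
      exact lt_of_le_of_ne (Bool.false_le _) hne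
  · refine ⟨0, fun i hi => absurd hi (Nat.not_lt_zero i), ?_⟩
    rw [hshift, Nat.zero_add, zeroPad_of_le α hrN hrL, h0]
    exact Bool.false_lt_true

theorem tendsto_zeroPad (α : Seq) : Tendsto (fun N => zeroPad α (N + 1)) atTop (nhds α) := by
  refine tendsto_pi_nhds.2 fun i => tendsto_const_nhds.congr' ?_
  filter_upwards [eventually_ge_atTop i] with N hN
  exact (zeroPad_of_lt α (by omega)).symm

/-- the periodic Parry sequences are dense in P. -/
theorem statement6 : ParryP ⊆ closure (ParryP ∩ PerSet) := by
  intro α hα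
  exact mem_closure_of_tendsto (tendsto_zeroPad α) (Eventually.of_forall fun N =>
    ⟨zeroPad_mem_ParryP hα N.succ_pos, zeroPad_mem_PerSet α N.succ_pos⟩)

end DoublingHole
end
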